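/- Let C be a full subcategory of mod Λ for an artin algebra Λ, with finitely many indecomposables, and suppose C is closed under submodules (every submodule of a module in C lies in C, up to isomorphism). Let M be the direct sum of one copy of each indecomposable in C. Then the global dimension of End_Λ(M) is at most 2. -/

import Mathlib

open CategoryTheory

/-- `N` belongs to `add M`: it is isomorphic to a direct summand (image of an idempotent
endomorphism) of a finite direct power of `M`. -/
def InAdd (Λ : Type*) [Ring Λ] (M : Type*) [AddCommGroup M] [Module Λ M]
    (N : Type*) [AddCommGroup N] [Module Λ N] : Prop :=
  ∃ (m : ℕ) (p : (Fin m → M) →ₗ[Λ] (Fin m → M)),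
    p ∘ₗ p = p ∧ Nonempty (N ≃ₗ[Λ] LinearMap.range p)

/-- `X` has projective dimension `≤ d`: it admits a projective resolution vanishing in
degrees `> d`. -/
def HasPDLe (Γ : Type*) [Ring Γ] (X : ModuleCat Γ) (d : ℕ) : Prop :=
  ∃ (P : ℕ → ModuleCat Γ) (f : ∀ n, P (n + 1) ⟶ P n) (ε : P 0 ⟶ X),
    (∀ n, Module.Projective Γ (P n)) ∧ Function.Surjective ε ∧
    Function.Exact (f 0) ε ∧ (∀ n, Function.Exact (f (n + 1)) (f n)) ∧
    (∀ n, d < n → ∀ x : P n, x = 0)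


universe u v w

theorem aux_small_of_ext {N : Type u} [AddCommGroup N] (S : AddSubgroup N)
    (h1 : Small.{v} S) (h2 : Small.{v} (N ⧸ S)) : Small.{v} N := by
  have key : ∀ x : N, x - (QuotientAddGroup.mk x : N ⧸ S).out ∈ S := fun x => by
    rw [← QuotientAddGroup.eq_zero_iff]
    simp
  refine small_of_injective (β := (N ⧸ S) × S)
    (f := fun x => (QuotientAddGroup.mk x, ⟨_, key x⟩)) ?_
  intro x y hxy
  simp only [Prod.mk.injEq, Subtype.mk.injEq] at hxy
  obtain ⟨h, h'⟩ := hxy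
  rw [h] at h'
  exact sub_left_injective h'

theorem aux_small_killed {R : Type w} [CommRing R] (I : Ideal R) [Small.{v} (R ⧸ I)]
    {N : Type u} [AddCommGroup N] [Module R N] [Module.Finite R N]
    (h : ∀ r ∈ I, ∀ x : N, r • x = 0) : Small.{v} N := by
  obtain ⟨n, s, hs⟩ := Module.Finite.exists_fin (R := R) (M := N)
  refine small_of_surjective (α := Fin n → R ⧸ I) (f := fun c => ∑ i, (c i).out • s i) ?_
  intro x
  have hx : x ∈ Submodule.span R (Set.range s) := hs ▸ Submodule.mem_top
  obtain ⟨c, rfl⟩ := (Submodule.mem_span_range_iff_exists_fun R).1 hx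
  refine ⟨fun i => Ideal.Quotient.mk I (c i), Finset.sum_congr rfl fun i _ => ?_⟩
  rw [← sub_eq_zero, ← sub_smul]
  apply h
  rw [← Ideal.Quotient.eq_zero_iff_mem, map_sub, sub_eq_zero]
  exact Quotient.out_eq _

theorem aux_small_pow {R : Type w} [CommRing R] [IsNoetherianRing R]
    (I : Ideal R) [Small.{v} (R ⧸ I)] (k : ℕ) :
    ∀ {N : Type u} [AddCommGroup N] [Module R N] [Module.Finite R N]
      (_ : ∀ r ∈ I ^ k, ∀ x : N, r • x = 0), Small.{v} N := by
  induction k with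
  | zero =>
    intro N _ _ _ h
    have : Subsingleton N := ⟨fun x y => by
      have h1 := h 1 (by simp) x
      have h2 := h 1 (by simp) y
      rw [one_smul] at h1 h2
      rw [h1, h2]⟩
    infer_instance
  | succ k ih =>
    intro N _ _ _ h
    let S : Submodule R N := I • (⊤ : Submodule R N)
    have h1 : Small.{v} S := by
      apply ih
      rintro r hr ⟨x, hx⟩
      apply Subtype.ext
      change r • x = 0
      refine Submodule.smul_induction_on hx ?_ ?_
      · intro a ha y _
        rw [smul_smul]
        exact h _ (by rw [pow_succ]; exact Ideal.mul_mem_mul hr ha) y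
      · intro x y hx hy
        rw [smul_add, hx, hy, add_zero]
    have h2 : Small.{v} (N ⧸ S) := by
      apply aux_small_killed I
      intro r hr x
      obtain ⟨x, rfl⟩ := Submodule.Quotient.mk_surjective _ x
      rw [← Submodule.Quotient.mk_smul, Submodule.Quotient.mk_eq_zero]
      exact Submodule.smul_mem_smul hr trivial
    exact aux_small_of_ext S.toAddSubgroup h1 h2

theorem aux_idem {R : Type w} [CommRing R] [IsArtinianRing R]
    {Γ : Type u} [Ring Γ] [Algebra R Γ] [Module.Finite R Γ]
    (X : Type v) [AddCommGroup X] [Module Γ X] [Module.Finite Γ X] :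
    ∃ E : Γ, E * E = E ∧ (∀ γ, E * γ = γ * E) ∧ (∀ x : X, E • x = x) ∧
      Small.{v} {γ : Γ // E * γ = γ} := by
  let : Module R X := Module.compHom X (algebraMap R Γ)
  have hsm : ∀ (r : R) (x : X), r • x = algebraMap R Γ r • x := fun _ _ => rfl
  have : IsScalarTower R Γ X := ⟨fun r g x => by
    rw [hsm, smul_smul, Algebra.smul_def]⟩
  have : Module.Finite R X := Module.Finite.trans Γ X
  let I : Ideal R := Module.annihilator R X
  have : Small.{v} (R ⧸ I) := by
    obtain ⟨n, s, hs⟩ := Module.Finite.exists_fin (R := R) (M := X)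
    refine small_of_injective (β := Fin n → X) (f := fun c i => c.out • s i) ?_
    intro a b hab
    rw [← Quotient.out_eq a, ← Quotient.out_eq b]
    change Ideal.Quotient.mk I _ = Ideal.Quotient.mk I _
    rw [← sub_eq_zero, ← map_sub, Ideal.Quotient.eq_zero_iff_mem, Module.mem_annihilator]
    intro x
    have hx : x ∈ Submodule.span R (Set.range s) := hs ▸ Submodule.mem_top
    obtain ⟨c, rfl⟩ := (Submodule.mem_span_range_iff_exists_fun R).1 hx
    rw [Finset.smul_sum]
    refine Finset.sum_eq_zero fun i _ => ?_
    have := congrFun hab i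
    simp only at this
    rw [smul_comm, sub_smul, this, sub_self, smul_zero]
  obtain ⟨k, hk⟩ := IsArtinian.monotone_stabilizes
    (⟨fun n => OrderDual.toDual (I ^ n), fun a b h => Ideal.pow_le_pow_right h⟩ :
      ℕ →o (Ideal R)ᵒᵈ)
  have hk' : ∀ m, k ≤ m → I ^ k = I ^ m := fun m hm => hk m hm
  have hid : IsIdempotentElem (I ^ (k + 1)) := by
    change I ^ (k + 1) * I ^ (k + 1) = _
    rw [← pow_add, ← hk' (k + 1 + (k + 1)) (by omega), ← hk' (k + 1) (by omega)]
  obtain ⟨f, hf, hfs⟩ := (Ideal.isIdempotentElem_iff_of_fg _ (IsNoetherian.noetherian _)).1 hid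
  have hfI : f ∈ I := by
    have : f ∈ I ^ (k + 1) := hfs ▸ Submodule.mem_span_singleton_self f
    exact Ideal.pow_le_self (by omega) this
  have hff : f * f = f := hf
  refine ⟨algebraMap R Γ (1 - f), ?_, fun γ => Algebra.commutes _ _, fun x => ?_, ?_⟩
  · rw [← map_mul]
    congr 1
    linear_combination hff
  · rw [← hsm, sub_smul, one_smul, Module.mem_annihilator.1 hfI, sub_zero]
  · let S : Submodule R Γ := LinearMap.ker
      (LinearMap.lsmul R Γ f)
    have hS : Small.{v} S := by
      apply aux_small_pow I (k + 1)
      rintro r hr ⟨x, hx⟩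
      apply Subtype.ext
      change r • x = 0
      have hx' : f • x = 0 := hx
      have hr' : r ∈ Ideal.span {f} := by rw [hfs] at hr; exact hr
      obtain ⟨c, rfl⟩ := Ideal.mem_span_singleton'.1 hr'
      rw [mul_smul, hx', smul_zero]
    refine small_of_injective (β := S) (f := fun γ => ⟨γ.1, ?_⟩) ?_
    · have := γ.2
      rw [← Algebra.smul_def, sub_smul, one_smul] at this
      change f • γ.1 = 0
      simpa using this
    · intro a b h
      exact Subtype.ext (congrArg (fun s : S => s.1) h)

section
variable {Λ : Type u} [Ring Λ] {M : Type v} [AddCommGroup M] [Module Λ M]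

def auxPre {N N' : Type*} [AddCommGroup N] [Module Λ N] [AddCommGroup N'] [Module Λ N']
    (g : N →ₗ[Λ] N') : (N' →ₗ[Λ] M) →ₗ[Module.End Λ M] (N →ₗ[Λ] M) where
  toFun h := h ∘ₗ g
  map_add' _ _ := rfl
  map_smul' _ _ := rfl

theorem aux_proj_hom {N : Type*} [AddCommGroup N] [Module Λ N] (h : InAdd Λ M N) :
    Module.Projective (Module.End Λ M) (N →ₗ[Λ] M) := by
  obtain ⟨m, p, hp, ⟨e⟩⟩ := h
  have : Module.Projective (Module.End Λ M) (Fin m → Module.End Λ M) := inferInstance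
  have : Module.Projective (Module.End Λ M) ((Fin m → M) →ₗ[Λ] M) :=
    Module.Projective.of_equiv (M := Fin m → Module.End Λ M)
      (LinearMap.lsum Λ (fun _ : Fin m => M) (Module.End Λ M))
  refine Module.Projective.of_split
    (auxPre (e.symm.toLinearMap ∘ₗ p.rangeRestrict))
    (auxPre ((LinearMap.range p).subtype ∘ₗ e.toLinearMap)) ?_
  ext h y
  change h (e.symm (p.rangeRestrict (e y : Fin m → M))) = h y
  congr 1
  rw [LinearEquiv.symm_apply_eq]
  apply Subtype.ext
  obtain ⟨z, hz⟩ := (e y).2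
  change p (e y : Fin m → M) = e y
  rw [← hz]
  exact LinearMap.congr_fun hp z

theorem aux_ker_proj [IsNoetherianRing (Module.End Λ M)]
    (hC : ∀ (k : ℕ) (N : Submodule Λ (Fin k → M)), InAdd Λ M N) (n m : ℕ)
    (ψ : (Fin n → Module.End Λ M) →ₗ[Module.End Λ M] (Fin m → Module.End Λ M)) :
    Module.Projective (Module.End Λ M) (LinearMap.ker ψ) := by
  let T : (Fin n → Module.End Λ M) ≃ₗ[Module.End Λ M] ((Fin n → M) →ₗ[Λ] M) :=
    LinearMap.lsum Λ (fun _ : Fin n => M) (Module.End Λ M)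
  have hT : ∀ γ x, T γ x = ∑ i, γ i (x i) := fun γ x => by
    simp [T, LinearMap.lsum_apply]
  have hψ : ∀ γ j x, ψ γ j x = T γ (fun i => ψ (Pi.single i 1) j x) := fun γ j x => by
    rw [hT]
    conv_lhs => rw [pi_eq_sum_univ' γ]
    rw [map_sum, Finset.sum_apply, LinearMap.sum_apply]
    refine Finset.sum_congr rfl fun i _ => ?_
    rw [map_smul]
    simp only [Pi.smul_apply, smul_eq_mul, Module.End.mul_apply]
  have hmem : ∀ γ, γ ∈ LinearMap.ker ψ ↔
      ∀ j x, T γ (fun i => ψ (Pi.single i 1) j x) = 0 := fun γ => by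
    rw [LinearMap.mem_ker]
    constructor
    · intro h j x
      rw [← hψ, h]; rfl
    · intro h
      ext j x
      rw [hψ, h]; rfl
  obtain ⟨k, s, hs⟩ := Module.Finite.exists_fin (R := Module.End Λ M) (M := LinearMap.ker ψ)
  let Φ : (Fin n → M) →ₗ[Λ] (Fin k → M) := LinearMap.pi fun l => T (s l).1
  have := aux_proj_hom (hC k (LinearMap.range Φ))
  let G : (LinearMap.range Φ →ₗ[Λ] M) →ₗ[Module.End Λ M] LinearMap.ker ψ :=
    LinearMap.codRestrict _ (T.symm.toLinearMap ∘ₗ auxPre Φ.rangeRestrict) (by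
      intro h
      rw [hmem]
      intro j x
      change T (T.symm (h ∘ₗ Φ.rangeRestrict)) _ = 0
      rw [LinearEquiv.apply_symm_apply]
      change h (Φ.rangeRestrict _) = 0
      convert map_zero h
      apply Subtype.ext
      ext l
      exact (hmem _).1 (s l).2 j x)
  have hG : ∀ h, T (G h).1 = h ∘ₗ Φ.rangeRestrict := fun h =>
    LinearEquiv.apply_symm_apply T _
  refine Module.Projective.of_equiv (LinearEquiv.ofBijective G ⟨?_, ?_⟩)
  · intro a b hab
    have : a ∘ₗ Φ.rangeRestrict = b ∘ₗ Φ.rangeRestrict := by rw [← hG, ← hG, hab]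
    ext y
    obtain ⟨x, rfl⟩ := Φ.surjective_rangeRestrict y
    exact LinearMap.congr_fun this x
  · intro y
    have hy : y ∈ Submodule.span (Module.End Λ M) (Set.range s) := hs ▸ Submodule.mem_top
    obtain ⟨c, rfl⟩ := (Submodule.mem_span_range_iff_exists_fun _).1 hy
    refine ⟨(∑ l, c l ∘ₗ LinearMap.proj l) ∘ₗ (LinearMap.range Φ).subtype, ?_⟩
    apply Subtype.ext
    apply T.injective
    rw [hG]
    refine LinearMap.ext fun x => ?_
    simp [Φ]
end

def auxFix {Γ : Type u} [Ring Γ] (E : Γ) (hE : ∀ γ, E * γ = γ * E)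
    (P : Type v) [AddCommGroup P] [Module Γ P] : Submodule Γ P where
  carrier := {x | E • x = x}
  add_mem' := by
    intro a b ha hb
    simp only [Set.mem_ofPred_eq] at *
    rw [smul_add, ha, hb]
  zero_mem' := smul_zero _
  smul_mem' := by
    intro c x hx
    simp only [Set.mem_ofPred_eq] at *
    rw [smul_smul, hE, mul_smul, hx]

def auxProj {Γ : Type u} [Ring Γ] (E : Γ) (hE : ∀ γ, E * γ = γ * E) (hEE : E * E = E)
    (P : Type v) [AddCommGroup P] [Module Γ P] : P →ₗ[Γ] auxFix E hE P where
  toFun x := ⟨E • x, by change E • E • x = E • x; rw [smul_smul, hEE]⟩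
  map_add' x y := Subtype.ext (smul_add _ _ _)
  map_smul' c x := Subtype.ext (by
    change E • c • x = c • E • x
    rw [smul_smul, smul_smul, hE])

theorem aux_fix_proj {Γ : Type u} [Ring Γ] (E : Γ) (hE : ∀ γ, E * γ = γ * E) (hEE : E * E = E)
    (P : Type v) [AddCommGroup P] [Module Γ P] [Module.Projective Γ P] :
    Module.Projective Γ (auxFix E hE P) :=
  Module.Projective.of_split (auxFix E hE P).subtype (auxProj E hE hEE P)
    (by ext x; exact x.2)

theorem aux_fix_small {Γ : Type u} [Ring Γ] (E : Γ) (hE : ∀ γ, E * γ = γ * E)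
    [Small.{w} {γ : Γ // E * γ = γ}] (n : ℕ) : Small.{w} (auxFix E hE (Fin n → Γ)) := by
  refine small_of_injective (β := Fin n → {γ : Γ // E * γ = γ})
    (f := fun x i => ⟨x.1 i, congrFun x.2 i⟩) ?_
  intro a b h
  ext i
  exact congrArg Subtype.val (congrFun h i)

def auxP {Γ : Type u} [Ring Γ] (A B C : ModuleCat.{v} Γ) : ℕ → ModuleCat.{v} Γ
  | 0 => C
  | 1 => B
  | 2 => A
  | _ + 3 => ModuleCat.of Γ PUnit

def auxF {Γ : Type u} [Ring Γ] {A B C : ModuleCat.{v} Γ} (i : A ⟶ B) (f : B ⟶ C) :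
    ∀ n, auxP A B C (n + 1) ⟶ auxP A B C n
  | 0 => f
  | 1 => i
  | _ + 2 => 0

theorem aux_res {Γ : Type u} [Ring Γ] (X : ModuleCat.{v} Γ) (A B C : ModuleCat.{v} Γ)
    [Module.Projective Γ A] [Module.Projective Γ B] [Module.Projective Γ C]
    (i : A ⟶ B) (f : B ⟶ C) (ε : C ⟶ X) (hε : Function.Surjective ε)
    (h0 : Function.Exact f ε) (h1 : Function.Exact i f) (hi : Function.Injective i) :
    HasPDLe Γ X 2 := by
  refine ⟨auxP A B C, auxF i f, ε, ?_, hε, h0, ?_, ?_⟩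
  · rintro (_ | _ | _ | n)
    · assumption
    · assumption
    · assumption
    · change Module.Projective Γ PUnit.{v + 1}
      infer_instance
  · rintro (_ | _ | n)
    · exact h1
    · intro x
      constructor
      · intro hx
        refine ⟨0, ?_⟩
        rw [map_zero]
        symm
        apply hi
        exact hx.trans (map_zero i.hom).symm
      · rintro ⟨y, rfl⟩
        exact map_zero i.hom
    · intro x
      exact ⟨fun _ => ⟨0, rfl⟩, fun _ => rfl⟩
  · rintro (_ | _ | _ | n) hn x
    · omega
    · omega
    · omega
    · rfl

theorem aux_res_small {Γ : Type u} [Ring Γ] (X : ModuleCat.{v} Γ) (B C : Type w)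
    [AddCommGroup B] [Module Γ B] [AddCommGroup C] [Module Γ C]
    [Small.{v} B] [Small.{v} C]
    [Module.Projective Γ B] [Module.Projective Γ C]
    (f : B →ₗ[Γ] C) (ε : C →ₗ[Γ] X) (hε : Function.Surjective ε)
    (h0 : Function.Exact f ε) [Module.Projective Γ (LinearMap.ker f)] :
    HasPDLe Γ X 2 := by
  let eB : Shrink.{v} B ≃ₗ[Γ] B := Shrink.linearEquiv Γ B
  let eC : Shrink.{v} C ≃ₗ[Γ] C := Shrink.linearEquiv Γ C
  let A := LinearMap.ker f
  let eA : Shrink.{v} A ≃ₗ[Γ] A := Shrink.linearEquiv Γ A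
  have : Module.Projective Γ (ModuleCat.of Γ (Shrink.{v} A)) := .of_equiv eA.symm
  have : Module.Projective Γ (ModuleCat.of Γ (Shrink.{v} B)) := .of_equiv eB.symm
  have : Module.Projective Γ (ModuleCat.of Γ (Shrink.{v} C)) := .of_equiv eC.symm
  refine aux_res X (ModuleCat.of Γ (Shrink.{v} A)) (ModuleCat.of Γ (Shrink.{v} B))
    (ModuleCat.of Γ (Shrink.{v} C))
    (ModuleCat.ofHom (eB.symm.toLinearMap ∘ₗ A.subtype ∘ₗ eA.toLinearMap))
    (ModuleCat.ofHom (eC.symm.toLinearMap ∘ₗ f ∘ₗ eB.toLinearMap))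
    (ModuleCat.ofHom (ε ∘ₗ eC.toLinearMap)) ?_ ?_ ?_ ?_
  · exact hε.comp eC.surjective
  · intro x
    change ε (eC x) = 0 ↔ ∃ y, eC.symm (f (eB y)) = x
    rw [h0]
    constructor
    · rintro ⟨y, hy⟩
      exact ⟨eB.symm y, by simp [hy]⟩
    · rintro ⟨y, rfl⟩
      exact ⟨eB y, by simp⟩
  · intro x
    change eC.symm (f (eB x)) = 0 ↔ ∃ y, eB.symm ((eA y : A) : B) = x
    constructor
    · intro hx
      have : f (eB x) = 0 := by simpa using hx
      exact ⟨eA.symm ⟨eB x, this⟩, by simp⟩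
    · rintro ⟨y, rfl⟩
      have : f (eA y : A).1 = 0 := (eA y).2
      simp [this]
  · exact eB.symm.injective.comp (Subtype.val_injective.comp eA.injective)

theorem aux_main {R : Type*} [CommRing R] [IsArtinianRing R]
    {Γ : Type u} [Ring Γ] [Algebra R Γ] [Module.Finite R Γ] [IsNoetherianRing Γ]
    (hK : ∀ (n m : ℕ) (ψ : (Fin n → Γ) →ₗ[Γ] (Fin m → Γ)),
      Module.Projective Γ (LinearMap.ker ψ))
    (X : ModuleCat.{v} Γ) [Module.Finite Γ X] : HasPDLe Γ X 2 := by
  obtain ⟨E, hEE, hE, hEX, hsm⟩ := aux_idem (R := R) (Γ := Γ) X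
  obtain ⟨m, π, hπ⟩ := Module.Finite.exists_fin' Γ X
  let C := auxFix E hE (Fin m → Γ)
  let ε : C →ₗ[Γ] X := π ∘ₗ C.subtype
  have hε : Function.Surjective ε := fun x => by
    obtain ⟨y, rfl⟩ := hπ x
    refine ⟨auxProj E hE hEE _ y, ?_⟩
    change π (E • y) = π y
    rw [map_smul, hEX]
  obtain ⟨n, θ, hθ⟩ := Module.Finite.exists_fin' Γ (LinearMap.ker ε)
  let B := auxFix E hE (Fin n → Γ)
  let f : B →ₗ[Γ] C := (LinearMap.ker ε).subtype ∘ₗ θ ∘ₗ B.subtype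
  have : Small.{v} B := aux_fix_small E hE n
  have : Small.{v} C := aux_fix_small E hE m
  have : Module.Projective Γ B := aux_fix_proj E hE hEE _
  have : Module.Projective Γ C := aux_fix_proj E hE hEE _
  let ψ : (Fin n → Γ) →ₗ[Γ] (Fin m → Γ) := C.subtype ∘ₗ (LinearMap.ker ε).subtype ∘ₗ θ
  have := hK n m ψ
  have : Module.Projective Γ (LinearMap.ker f) := by
    refine Module.Projective.of_split (M := LinearMap.ker ψ)
      (LinearMap.codRestrict _ (B.subtype ∘ₗ (LinearMap.ker f).subtype) ?_)
      (LinearMap.codRestrict _ (auxProj E hE hEE _ ∘ₗ (LinearMap.ker ψ).subtype) ?_) ?_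
    · rintro ⟨x, hx⟩
      have hx' : f x = 0 := hx
      exact congrArg Subtype.val hx'
    · rintro ⟨x, hx⟩
      have hx' : ψ x = 0 := hx
      apply Subtype.ext
      change ψ (E • x) = 0
      rw [map_smul, hx', smul_zero]
    · ext1 x
      exact Subtype.ext (Subtype.ext x.1.2)
  refine aux_res_small X B C f ε hε ?_
  intro x
  constructor
  · intro hx
    obtain ⟨y, hy⟩ := hθ ⟨x, hx⟩
    refine ⟨auxProj E hE hEE _ y, ?_⟩
    change ((θ (E • y) : LinearMap.ker ε) : C) = x
    rw [map_smul, hy]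
    exact Subtype.ext x.2
  · rintro ⟨y, rfl⟩
    exact (θ y.1).2

/-- Let `Λ` be an artin algebra and `C` a full subcategory of `mod Λ` with
finitely many indecomposables, closed under submodules, and let `M` be an additive
generator of `C` (the direct sum of one copy of each indecomposable of `C`); the closure
hypothesis says every submodule of a finite direct power of `M` lies in `add M`.
Then the global dimension of `End_Λ(M)` is at most `2`: every finitely generated
`End_Λ(M)`-module has projective dimension `≤ 2`. -/
theorem gldim_le_two_of_closed_under_submodules
    {R : Type*} [CommRing R] [IsArtinianRing R]
    {Λ : Type*} [Ring Λ] [Algebra R Λ] [Module.Finite R Λ] [IsArtinianRing Λ]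
    (M : Type*) [AddCommGroup M] [Module Λ M] [Module.Finite Λ M]
    (hC : ∀ (k : ℕ) (N : Submodule Λ (Fin k → M)), InAdd Λ M N) :
    ∀ X : ModuleCat (Module.End Λ M),
      Module.Finite (Module.End Λ M) X → HasPDLe (Module.End Λ M) X 2 := by
  intro X hX
  let : Module R M := Module.compHom M (algebraMap R Λ)
  have hsm : ∀ (r : R) (x : M), r • x = algebraMap R Λ r • x := fun _ _ => rfl
  have : IsScalarTower R Λ M := ⟨fun r g x => by
    rw [hsm, smul_smul, Algebra.smul_def]⟩
  have : Module.Finite R M := Module.Finite.trans Λ M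
  have : SMulCommClass Λ R M := IsScalarTower.to_smulCommClass'
  let J : Module.End Λ M →ₗ[R] (M →ₗ[R] M) :=
    { toFun := fun g => g.restrictScalars R
      map_add' := fun _ _ => rfl
      map_smul' := fun _ _ => rfl }
  have : Module.Finite R (Module.End Λ M) :=
    Module.Finite.of_injective J (LinearMap.restrictScalars_injective R)
  have : IsNoetherianRing (Module.End Λ M) := isNoetherian_of_tower R inferInstance
  exact aux_main (R := R) (fun n m ψ => aux_ker_proj hC n m ψ) X
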